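/- Let X be a metrizable space and let AM*(X) be the set of all admissible metrics on X (not necessarily bounded), endowed with the topology of uniform convergence on X × X. If AM*(X) is completely metrizable, then X is σ-locally compact, i.e., X is a countable union of closed locally compact subspaces. -/

import Mathlib

open Set Filter Topology UniformConvergence

/-- `d : X × X → ℝ` is a metric on `X`. -/
def IsMetricFun {X : Type*} (d : X × X → ℝ) : Prop :=
  (∀ x y : X, d (x, y) = 0 ↔ x = y) ∧ (∀ x y : X, d (x, y) = d (y, x)) ∧
    (∀ x y z : X, d (x, z) ≤ d (x, y) + d (y, z))

/-- `d` induces the topology of `X`, i.e. `d` is an admissible metric. -/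
def InducesTopology {X : Type*} [TopologicalSpace X] (d : X × X → ℝ) : Prop :=
  ∀ s : Set X, IsOpen s ↔ ∀ x ∈ s, ∃ ε > 0, ∀ y : X, d (x, y) < ε → y ∈ s

/-- `d` is a bounded real-valued function. -/
def BoundedFun {X : Type*} (d : X × X → ℝ) : Prop := ∃ C : ℝ, ∀ p : X × X, |d p| ≤ C

/-- `AM X`: the set of bounded admissible metrics on `X`, regarded as a subset of the space
`C(X²)` of bounded continuous real-valued functions on `X × X`, which carries the
sup-metric (every admissible metric is continuous on `X × X`, so bounded admissible
metrics are exactly the elements of `C(X²)` satisfying the two conditions below). -/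
def AM (X : Type*) [TopologicalSpace X] : Set (BoundedContinuousFunction (X × X) ℝ) :=
  {f | IsMetricFun (⇑f) ∧ InducesTopology (⇑f)}

/-- A topological space is completely metrizable if its topology is induced by some
complete metric. -/
def CompletelyMetrizable (Z : Type*) [t : TopologicalSpace Z] : Prop :=
  ∃ m : MetricSpace Z, m.toPseudoMetricSpace.toUniformSpace.toTopologicalSpace = t ∧
    @CompleteSpace Z m.toPseudoMetricSpace.toUniformSpace

/-- A topological space is σ-locally compact if it is a countable union of closed
locally compact subspaces. -/
def SigmaLocallyCompact (Z : Type*) [TopologicalSpace Z] : Prop :=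
  ∃ F : ℕ → Set Z, (∀ n, IsClosed (F n)) ∧ (∀ n, LocallyCompactSpace (F n)) ∧
    (⋃ n, F n) = Set.univ

/-- `AM*(X)`: the set of all (not necessarily bounded) admissible metrics on `X`,
regarded as a subset of the space `(X × X) →ᵤ ℝ` of real-valued functions on `X × X`
with the topology of uniform convergence. -/
def AMstar (X : Type*) [TopologicalSpace X] : Set ((X × X) →ᵤ ℝ) :=
  {d | IsMetricFun (UniformFun.toFun d) ∧ InducesTopology (UniformFun.toFun d)}

/-- The image of a complete metric space under a topological inducing map into a Hausdorff space
is a `Gδ` subset of its closure. -/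
theorem exists_isOpen_closure_range_inter_subset {A E : Type*} [MetricSpace A] [CompleteSpace A]
    [TopologicalSpace E] [T2Space E] {i : A → E} (hi : IsInducing i) :
    ∃ G : ℕ → Set E, (∀ n, IsOpen (G n)) ∧ (∀ n, range i ⊆ G n) ∧
      closure (range i) ∩ ⋂ n, G n ⊆ range i := by
  refine ⟨fun n ↦ ⋃₀ {V | IsOpen V ∧ ∀ a b, i a ∈ V → i b ∈ V → dist a b < 1 / ((n : ℝ) + 1)},
    fun n ↦ isOpen_sUnion fun V hV ↦ hV.1, ?_, ?_⟩
  · rintro n _ ⟨a, rfl⟩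
    obtain ⟨V, hV, hVa⟩ := hi.isOpen_iff.1
      (Metric.isOpen_ball : IsOpen (Metric.ball a (1 / ((n : ℝ) + 1) / 2)))
    refine ⟨V, ⟨hV, fun b c hb hc ↦ ?_⟩, ?_⟩
    · have hb' : b ∈ Metric.ball a (1 / ((n : ℝ) + 1) / 2) := hVa ▸ hb
      have hc' : c ∈ Metric.ball a (1 / ((n : ℝ) + 1) / 2) := hVa ▸ hc
      rw [Metric.mem_ball] at hb' hc'
      linarith [dist_triangle_right b c a]
    · have : a ∈ i ⁻¹' V := hVa ▸ Metric.mem_ball_self (by positivity)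
      exact this
  · rintro e ⟨he, hG⟩
    have hne : (comap i (𝓝 e)).NeBot := by
      rw [comap_neBot_iff]
      intro t ht
      obtain ⟨_, hx, a, rfl⟩ := mem_closure_iff_nhds.1 he t ht
      exact ⟨a, hx⟩
    have hc : Cauchy (comap i (𝓝 e)) := by
      refine Metric.cauchy_iff.2 ⟨hne, fun ε hε ↦ ?_⟩
      obtain ⟨n, hn⟩ := exists_nat_one_div_lt hε
      obtain ⟨V, ⟨hV, hVd⟩, heV⟩ := mem_iInter.1 hG n
      exact ⟨i ⁻¹' V, preimage_mem_comap (hV.mem_nhds heV),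
        fun a ha b hb ↦ (hVd a b ha hb).trans hn⟩
    obtain ⟨a, ha⟩ := CompleteSpace.complete hc
    exact ⟨a, tendsto_nhds_unique ((hi.continuous.tendsto a).mono_left ha) tendsto_comap⟩

theorem CompletelyMetrizable.exists_isOpen {E : Type*} [TopologicalSpace E] [T2Space E]
    {A : Set E} (h : CompletelyMetrizable A) :
    ∃ G : ℕ → Set E, (∀ n, IsOpen (G n)) ∧ (∀ n, A ⊆ G n) ∧ closure A ∩ ⋂ n, G n ⊆ A := by
  obtain ⟨m, hm, hc⟩ := h
  have hi : @IsInducing A E m.toPseudoMetricSpace.toUniformSpace.toTopologicalSpace _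
      (Subtype.val : A → E) := by
    rw [hm]; exact IsInducing.subtypeVal
  have := @exists_isOpen_closure_range_inter_subset A E m hc _ _ _ hi
  rwa [Subtype.range_coe] at this

section Glue

variable {X Y : Type*} [MetricSpace Y] {f : X → Y}

/-- The pseudometric on `X` obtained from the metric of `Y` by collapsing the zero set of `D`. -/
def collapse (f : X → Y) (D : Y → ℝ) (p : X × X) : ℝ :=
  min (dist (f p.1) (f p.2)) (D (f p.1) + D (f p.2))

/-- The distance to the pair `{a, b}`. -/
def pairDist (a b u : Y) : ℝ := min (dist u a) (dist u b)

theorem pairDist_nonneg (a b u : Y) : 0 ≤ pairDist a b u := le_min dist_nonneg dist_nonneg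

theorem pairDist_le (a b u v : Y) : pairDist a b u ≤ dist u v + pairDist a b v := by
  unfold pairDist
  have h1 := dist_triangle u v a
  have h2 := dist_triangle u v b
  grind

theorem pairDist_le_left (a a' b u : Y) : pairDist a b u ≤ pairDist a' b u + dist a a' := by
  unfold pairDist
  have h1 := dist_triangle_right u a a'
  have h2 : 0 ≤ dist a a' := dist_nonneg
  grind

theorem collapse_triangle (a b : Y) (x y z : X) :
    collapse f (pairDist a b) (x, z) ≤
      collapse f (pairDist a b) (x, y) + collapse f (pairDist a b) (y, z) := by
  have h1 := dist_triangle (f x) (f y) (f z)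
  have h2 := pairDist_le a b (f x) (f y)
  have h3 := pairDist_le a b (f z) (f y)
  have h4 := pairDist_nonneg a b (f y)
  rw [dist_comm (f z)] at h3
  simp only [collapse]
  grind

theorem collapse_self (a b : Y) (x : X) : collapse f (pairDist a b) (x, x) = 0 := by
  simpa [collapse] using pairDist_nonneg a b (f x)

theorem collapse_comm (D : Y → ℝ) (x y : X) : collapse f D (x, y) = collapse f D (y, x) := by
  simp [collapse, dist_comm, add_comm]

theorem collapse_pairDist_nonneg (a b : Y) (p : X × X) : 0 ≤ collapse f (pairDist a b) p :=
  le_min dist_nonneg (add_nonneg (pairDist_nonneg ..) (pairDist_nonneg ..))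

theorem continuous_collapse (b : Y) :
    Continuous fun a ↦ (UniformFun.ofFun (collapse f (pairDist a b)) : (X × X) →ᵤ ℝ) := by
  rw [continuous_iff_continuousAt]
  intro a
  rw [ContinuousAt, UniformFun.tendsto_iff_tendstoUniformly, Metric.tendstoUniformly_iff]
  intro ε hε
  filter_upwards [Metric.ball_mem_nhds a (half_pos hε)] with a' ha' p
  have ha : dist a' a < ε / 2 := ha'
  have h1 := pairDist_le_left a a' b (f p.1)
  have h2 := pairDist_le_left a a' b (f p.2)
  have h3 := pairDist_le_left a' a b (f p.1)
  have h4 := pairDist_le_left a' a b (f p.2)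
  rw [dist_comm a a'] at h1 h2
  simp only [Function.comp_apply, UniformFun.toFun_ofFun, Real.dist_eq, collapse]
  rw [abs_lt]
  grind

variable [TopologicalSpace X]

theorem mem_AMstar_of_le_of_lt (hf : IsEmbedding f) {q : X × X → ℝ} {L : ℝ} (hL : 0 < L)
    (hself : ∀ x, q (x, x) = 0) (hsymm : ∀ x y, q (x, y) = q (y, x))
    (htri : ∀ x y z, q (x, z) ≤ q (x, y) + q (y, z))
    (hle : ∀ x y, q (x, y) ≤ L * dist (f x) (f y))
    (hlt : ∀ x, ∀ ε > 0, ∃ δ > 0, ∀ y, q (x, y) < δ → dist (f x) (f y) < ε) :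
    UniformFun.ofFun q ∈ AMstar X := by
  refine ⟨⟨fun x y ↦ ⟨fun h ↦ ?_, ?_⟩, hsymm, htri⟩, fun s ↦ ?_⟩
  · refine hf.injective (dist_le_zero.1 (le_of_forall_pos_lt_add fun ε hε ↦ ?_))
    obtain ⟨δ, hδ, H⟩ := hlt x ε hε
    simpa using H y (by simpa [h] using (show q (x, y) = 0 from h).trans_lt hδ)
  · rintro rfl
    exact hself x
  · rw [isOpen_iff_mem_nhds]
    refine forall₂_congr fun x hx ↦ ?_
    rw [hf.isInducing.nhds_eq_comap, (Metric.nhds_basis_ball.comap f).mem_iff]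
    constructor
    · rintro ⟨ε, hε, h⟩
      obtain ⟨δ, hδ, H⟩ := hlt x ε hε
      exact ⟨δ, hδ, fun y hy ↦ h (by simpa [dist_comm] using H y hy)⟩
    · rintro ⟨ε, hε, h⟩
      refine ⟨ε / L, by positivity, fun y hy ↦ h y ((hle x y).trans_lt ?_)⟩
      have : dist (f x) (f y) < ε / L := by simpa [dist_comm] using hy
      rwa [lt_div_iff₀' hL] at this

theorem collapse_mem_AMstar (hf : IsEmbedding f) {a b : Y} (ha : a ∉ range f)
    (hb : b ∉ range f) : UniformFun.ofFun (collapse f (pairDist a b)) ∈ AMstar X := by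
  refine mem_AMstar_of_le_of_lt hf one_pos (collapse_self a b) (collapse_comm _)
    (collapse_triangle a b) (fun x y ↦ by simp [collapse]) fun x ε hε ↦ ?_
  have hD : 0 < pairDist a b (f x) :=
    lt_min (dist_pos.2 fun h ↦ ha ⟨x, h⟩) (dist_pos.2 fun h ↦ hb ⟨x, h⟩)
  refine ⟨min ε (pairDist a b (f x)), lt_min hε hD, fun y hy ↦ ?_⟩
  have := pairDist_nonneg a b (f y)
  simp only [collapse] at hy
  grind

theorem collapse_mem_closure_AMstar (hf : IsEmbedding f) (a b : Y) :
    UniformFun.ofFun (collapse f (pairDist a b)) ∈ closure (AMstar X) := by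
  set q : ℝ → X × X → ℝ := fun η p ↦
    collapse f (pairDist a b) p + η * min 1 (dist (f p.1) (f p.2)) with hq
  have hmem : ∀ η > 0, UniformFun.ofFun (q η) ∈ AMstar X := by
    intro η hη
    refine mem_AMstar_of_le_of_lt hf (L := 1 + η) (by positivity)
      (fun x ↦ by simp [hq, collapse_self]) (fun x y ↦ by simp [hq, dist_comm, collapse_comm _ x])
      (fun x y z ↦ ?_) (fun x y ↦ ?_) fun x ε hε ↦ ?_
    · have h1 := collapse_triangle (f := f) a b x y z
      have h2 : min 1 (dist (f x) (f z)) ≤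
          min 1 (dist (f x) (f y)) + min 1 (dist (f y) (f z)) := by
        have := dist_triangle (f x) (f y) (f z)
        have : 0 ≤ dist (f x) (f y) := dist_nonneg
        have : 0 ≤ dist (f y) (f z) := dist_nonneg
        grind
      have h3 := mul_le_mul_of_nonneg_left h2 hη.le
      simp only [hq]
      linarith
    · have h1 : collapse f (pairDist a b) (x, y) ≤ dist (f x) (f y) := min_le_left _ _
      have h2 := mul_le_mul_of_nonneg_left (min_le_right 1 (dist (f x) (f y))) hη.le
      simp only [hq]
      linarith
    · refine ⟨η * min 1 ε, by positivity, fun y hy ↦ ?_⟩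
      have h1 := collapse_pairDist_nonneg (f := f) a b (x, y)
      have h2 : η * min 1 (dist (f x) (f y)) < η * min 1 ε := by
        simp only [hq] at hy
        linarith
      have h3 := lt_of_mul_lt_mul_left h2 hη.le
      grind
  have hlim : Tendsto (fun η ↦ (UniformFun.ofFun (q η) : (X × X) →ᵤ ℝ)) (𝓝[>] 0)
      (𝓝 (UniformFun.ofFun (collapse f (pairDist a b)))) := by
    rw [UniformFun.tendsto_iff_tendstoUniformly, Metric.tendstoUniformly_iff]
    intro ε hε
    filter_upwards [Ioo_mem_nhdsGT hε] with η hη p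
    have h0 : 0 ≤ min 1 (dist (f p.1) (f p.2)) := le_min zero_le_one dist_nonneg
    have h1 : min 1 (dist (f p.1) (f p.2)) ≤ 1 := min_le_left _ _
    simp only [Function.comp_apply, UniformFun.toFun_ofFun, Real.dist_eq, hq]
    rw [abs_lt]
    constructor <;> nlinarith [hη.1, hη.2]
  exact mem_closure_of_tendsto hlim (eventually_mem_nhdsWithin.mono hmem)

theorem collapse_notMem_AMstar (hf : IsEmbedding f) {b : Y} (x : X) (hb : b ∉ range f)
    (hb' : b ∈ closure (range f)) :
    UniformFun.ofFun (collapse f (pairDist (f x) b)) ∉ AMstar X := by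
  rintro ⟨-, htop⟩
  have hr : 0 < dist (f x) b / 2 := half_pos (dist_pos.2 fun h ↦ hb ⟨x, h⟩)
  obtain ⟨ε, hε, H⟩ := (htop (f ⁻¹' Metric.ball (f x) (dist (f x) b / 2))).1
    (Metric.isOpen_ball.preimage hf.continuous) x (Metric.mem_ball_self hr)
  obtain ⟨_, ⟨y, rfl⟩, hy⟩ := Metric.mem_closure_iff.1 hb' _ (lt_min hε hr)
  have h1 : collapse f (pairDist (f x) b) (x, y) ≤ dist b (f y) := by
    refine (min_le_right _ _).trans ?_
    have h2 : pairDist (f x) b (f x) ≤ 0 := (min_le_left _ _).trans (dist_self _).le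
    have h3 : pairDist (f x) b (f y) ≤ dist (f y) b := min_le_right _ _
    rw [dist_comm] at h3
    simpa using add_le_add h2 h3
  have h2 : dist (f y) (f x) < dist (f x) b / 2 :=
    H y (h1.trans_lt (hy.trans_le (min_le_left _ _)))
  have h3 := hy.trans_le (min_le_right _ _)
  have h4 := dist_triangle (f x) (f y) b
  rw [dist_comm (f y)] at h2
  rw [dist_comm b] at h3
  linarith

end Glue

/-- If `AMstar X` is completely metrizable, then `X` is `Fσ` in every metrizable space. -/
theorem exists_isClosed_iUnion_eq_range {X Y : Type*} [TopologicalSpace X] [TopologicalSpace Y]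
    [TopologicalSpace.MetrizableSpace Y] (h : CompletelyMetrizable (AMstar X)) {f : X → Y}
    (hf : IsEmbedding f) : ∃ F : ℕ → Set Y, (∀ n, IsClosed (F n)) ∧ ⋃ n, F n = range f := by
  let _ := TopologicalSpace.metrizableSpaceMetric Y
  by_cases hcl : closure (range f) ⊆ range f
  · exact ⟨fun _ ↦ range f, fun _ ↦ isClosed_of_closure_subset hcl, iUnion_const _⟩
  obtain ⟨b, hb', hb⟩ := not_subset.1 hcl
  obtain ⟨G, hGo, hAG, hGA⟩ := h.exists_isOpen
  refine ⟨fun n ↦ {a | UniformFun.ofFun (collapse f (pairDist a b)) ∉ G n},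
    fun n ↦ ((hGo n).preimage (continuous_collapse b)).isClosed_compl, ?_⟩
  ext a
  simp only [mem_iUnion, mem_ofPred_eq]
  constructor
  · rintro ⟨n, hn⟩
    by_contra ha
    exact hn (hAG n (collapse_mem_AMstar hf ha hb))
  · rintro ⟨x, rfl⟩
    by_contra! hn
    exact collapse_notMem_AMstar hf x hb hb'
      (hGA ⟨collapse_mem_closure_AMstar hf _ _, mem_iInter.2 hn⟩)

section SigmaLocallyCompact

variable {X : Type*} [TopologicalSpace X]

/-- `F` is closed and every point has a neighbourhood whose trace on `F` is compact. -/
def IsClosedLocallyCompact (F : Set X) : Prop :=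
  IsClosed F ∧ ∀ x, ∃ N ∈ 𝓝 x, IsCompact (N ∩ F)

/-- `S` is covered by countably many closed locally compact sets. -/
def SigmaLocallyCompactCovered (S : Set X) : Prop :=
  ∃ F : ℕ → Set X, (∀ n, IsClosedLocallyCompact (F n)) ∧ S ⊆ ⋃ n, F n

theorem IsClosedLocallyCompact.locallyCompactSpace [T2Space X] {F : Set X}
    (hF : IsClosedLocallyCompact F) : LocallyCompactSpace F := by
  have : WeaklyLocallyCompactSpace F := ⟨fun x ↦ by
    obtain ⟨N, hN, hc⟩ := hF.2 x
    refine ⟨Subtype.val ⁻¹' N, ?_, ?_⟩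
    · rw [Subtype.isCompact_iff, Subtype.image_preimage_coe, inter_comm]
      exact hc
    · exact continuous_subtype_val.continuousAt hN⟩
  infer_instance

theorem IsClosedLocallyCompact.inter {F C : Set X} (hF : IsClosedLocallyCompact F)
    (hC : IsClosed C) : IsClosedLocallyCompact (F ∩ C) := by
  refine ⟨hF.1.inter hC, fun x ↦ ?_⟩
  obtain ⟨N, hN, hc⟩ := hF.2 x
  exact ⟨N, hN, by simpa only [inter_assoc] using hc.inter_right hC⟩

theorem LocallyFinite.isClosedLocallyCompact_iUnion [RegularSpace X] {ι : Type*}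
    {F : ι → Set X} (hlf : LocallyFinite F) (hF : ∀ i, IsClosedLocallyCompact (F i)) :
    IsClosedLocallyCompact (⋃ i, F i) := by
  refine ⟨hlf.isClosed_iUnion fun i ↦ (hF i).1, fun x ↦ ?_⟩
  obtain ⟨M, hM, hfin⟩ := hlf x
  choose N hN hc using fun i ↦ (hF i).2 x
  obtain ⟨K, hK, hKc, hKs⟩ := exists_mem_nhds_isClosed_subset
    (inter_mem hM ((biInter_mem hfin).2 fun i _ ↦ hN i))
  refine ⟨K, hK, ?_⟩
  have : K ∩ ⋃ i, F i = ⋃ i ∈ {i | (F i ∩ M).Nonempty}, K ∩ (N i ∩ F i) := by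
    ext y
    simp only [mem_inter_iff, mem_iUnion, exists_prop]
    constructor
    · rintro ⟨hy, i, hi⟩
      have hi' : (F i ∩ M).Nonempty := ⟨y, hi, (hKs hy).1⟩
      exact ⟨i, hi', hy, mem_iInter₂.1 (hKs hy).2 i hi', hi⟩
    · rintro ⟨i, -, hy, -, hi⟩
      exact ⟨hy, i, hi⟩
  rw [this]
  exact hfin.isCompact_biUnion fun i _ ↦ (hc i).inter_left hKc

theorem IsClosedLocallyCompact.sigmaLocallyCompactCovered {F : Set X}
    (hF : IsClosedLocallyCompact F) : SigmaLocallyCompactCovered F :=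
  ⟨fun _ ↦ F, fun _ ↦ hF, by rw [iUnion_const]⟩

theorem SigmaLocallyCompactCovered.mono {S T : Set X} (hT : SigmaLocallyCompactCovered T)
    (h : S ⊆ T) : SigmaLocallyCompactCovered S :=
  let ⟨F, hF, hs⟩ := hT
  ⟨F, hF, h.trans hs⟩

theorem SigmaLocallyCompactCovered.iUnion {S : ℕ → Set X}
    (h : ∀ n, SigmaLocallyCompactCovered (S n)) : SigmaLocallyCompactCovered (⋃ n, S n) := by
  choose F hF hS using h
  refine ⟨fun n ↦ F n.unpair.1 n.unpair.2, fun n ↦ hF _ _, iUnion_subset fun n x hx ↦ ?_⟩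
  obtain ⟨m, hm⟩ := mem_iUnion.1 (hS n hx)
  exact mem_iUnion.2 ⟨Nat.pair n m, by simpa using hm⟩

theorem SigmaLocallyCompactCovered.union {S T : Set X} (hS : SigmaLocallyCompactCovered S)
    (hT : SigmaLocallyCompactCovered T) : SigmaLocallyCompactCovered (S ∪ T) := by
  refine (SigmaLocallyCompactCovered.iUnion (S := fun n ↦ if n = 0 then S else T)
    fun n ↦ by split_ifs <;> assumption).mono ?_
  rintro x (hx | hx)
  · exact mem_iUnion.2 ⟨0, by simpa using hx⟩
  · exact mem_iUnion.2 ⟨1, by simpa using hx⟩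

theorem SigmaLocallyCompactCovered.sigmaLocallyCompact [T2Space X]
    (h : SigmaLocallyCompactCovered (univ : Set X)) : SigmaLocallyCompact X :=
  let ⟨F, hF, hs⟩ := h
  ⟨F, fun n ↦ (hF n).1, fun n ↦ (hF n).locallyCompactSpace, univ_subset_iff.1 hs⟩

/-- Being covered by countably many closed locally compact sets is a local property. -/
theorem SigmaLocallyCompactCovered.of_nhds [T2Space X] [ParacompactSpace X] {S : Set X}
    (h : ∀ x, ∃ V ∈ 𝓝 x, SigmaLocallyCompactCovered (V ∩ S)) : SigmaLocallyCompactCovered S := by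
  choose V hV F hF hVF using h
  obtain ⟨W, -, hWu, hWf, hWV⟩ := precise_refinement (fun x ↦ interior (V x))
    (fun x ↦ isOpen_interior) (iUnion_eq_univ_iff.2 fun x ↦ ⟨x, mem_interior_iff_mem_nhds.2 (hV x)⟩)
  refine ⟨fun n ↦ ⋃ x, F x n ∩ closure (W x), fun n ↦ ?_, fun y hy ↦ ?_⟩
  · exact (hWf.closure.subset fun x ↦ inter_subset_right).isClosedLocallyCompact_iUnion
      fun x ↦ (hF x n).inter isClosed_closure
  · obtain ⟨x, hx⟩ := iUnion_eq_univ_iff.1 hWu y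
    obtain ⟨n, hn⟩ := mem_iUnion.1 (hVF x ⟨interior_subset (hWV x hx), hy⟩)
    exact mem_iUnion.2 ⟨n, mem_iUnion.2 ⟨x, hn, subset_closure hx⟩⟩

/-- A closed set not covered by countably many closed locally compact sets has a nonempty closed
nowhere locally compact subset. -/
theorem exists_isClosed_nowhere_locallyCompact [TopologicalSpace.MetrizableSpace X] {Z : Set X}
    (hZ : IsClosed Z) (h : ¬ SigmaLocallyCompactCovered Z) :
    ∃ K ⊆ Z, IsClosed K ∧ K.Nonempty ∧ ∀ x ∈ K, ∀ N ∈ 𝓝 x, ¬ IsCompact (N ∩ K) := by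
  let _ := TopologicalSpace.metrizableSpaceMetric X
  set U : Set X := {x | ∃ V ∈ 𝓝 x, SigmaLocallyCompactCovered (V ∩ Z)} with hU
  have hUo : IsOpen U := by
    refine isOpen_iff_mem_nhds.2 fun x ⟨V, hV, hVZ⟩ ↦ ?_
    filter_upwards [eventually_mem_nhds_iff.2 hV] with y hy using ⟨V, hy, hVZ⟩
  have hUZ : SigmaLocallyCompactCovered (U ∩ Z) := by
    obtain ⟨C, hCc, -, hCU, -⟩ := hUo.exists_iUnion_isClosed
    have : ∀ n, SigmaLocallyCompactCovered (C n ∩ Z) := by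
      refine fun n ↦ .of_nhds fun x ↦ ?_
      by_cases hx : x ∈ C n
      · obtain ⟨V, hV, hVZ⟩ : x ∈ U := hCU ▸ mem_iUnion.2 ⟨n, hx⟩
        exact ⟨V, hV, hVZ.mono (by grind)⟩
      · refine ⟨(C n)ᶜ, (hCc n).isOpen_compl.mem_nhds hx, fun _ ↦ ∅,
          fun _ ↦ ⟨isClosed_empty, fun x ↦ ⟨univ, univ_mem, by simp⟩⟩, by grind⟩
    exact (SigmaLocallyCompactCovered.iUnion this).mono (by rw [← hCU, iUnion_inter])
  refine ⟨Z \ U, sdiff_subset, hZ.sdiff hUo, ?_, ?_⟩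
  · by_contra hne
    rw [not_nonempty_iff_eq_empty, sdiff_eq_empty] at hne
    exact h (hUZ.mono (subset_inter hne Subset.rfl))
  · rintro x ⟨hxZ, hxU⟩ N hN hc
    refine hxU ⟨N, hN, ?_⟩
    have : SigmaLocallyCompactCovered (N ∩ (Z \ U)) :=
      IsClosedLocallyCompact.sigmaLocallyCompactCovered
        ⟨hc.isClosed, fun x ↦ ⟨univ, univ_mem, by simpa using hc⟩⟩
    exact (this.union hUZ).mono (by grind)

end SigmaLocallyCompact

section NoncompactSequences

variable {X : Type*} [MetricSpace X]

theorem exists_separated_net (Z : Set X) {r : ℝ} (hr : 0 < r) :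
    ∃ S ⊆ Z, S.Pairwise (fun x y ↦ r ≤ dist x y) ∧ ∀ z ∈ Z, ∃ s ∈ S, dist z s < r := by
  obtain ⟨S, hS⟩ := zorn_subset {S | S ⊆ Z ∧ S.Pairwise (fun x y ↦ r ≤ dist x y)}
    fun c hc hch ↦ ⟨⋃₀ c, ⟨sUnion_subset fun s hs ↦ (hc hs).1,
      (pairwise_sUnion hch.directedOn).2 fun s hs ↦ (hc hs).2⟩, fun s ↦ subset_sUnion_of_mem⟩
  refine ⟨S, hS.prop.1, hS.prop.2, fun z hz ↦ ?_⟩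
  by_contra! h
  have hz' : z ∈ S := hS.le_of_ge (y := insert z S)
    ⟨insert_subset hz hS.prop.1, hS.prop.2.insert fun y hy _ ↦
      ⟨h y hy, by simpa [dist_comm] using h y hy⟩⟩ (subset_insert z S) (mem_insert z S)
  have := h z hz'
  rw [dist_self] at this
  exact hr.not_ge this

theorem exists_seq_forall_not_mapClusterPt {Z : Set X} (hZ : IsClosed Z) {z : X}
    (hn : ∀ N ∈ 𝓝 z, ¬ IsCompact (N ∩ Z)) {N : Set X} (hN : N ∈ 𝓝 z) :
    ∃ s : ℕ → X, (∀ n, s n ∈ N ∩ Z) ∧ ∀ x, ¬ MapClusterPt x atTop s := by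
  obtain ⟨M, hM, hMc, hMN⟩ := exists_mem_nhds_isClosed_subset hN
  have h := hn M hM
  rw [isCompact_iff_isSeqCompact] at h
  simp only [IsSeqCompact, not_forall] at h
  obtain ⟨s, hs, h⟩ := h
  refine ⟨s, fun n ↦ ⟨hMN (hs n).1, (hs n).2⟩, fun x hx ↦ h ?_⟩
  obtain ⟨ψ, hψ, hlim⟩ := hx.tendsto_subseq
  exact ⟨x, (hMc.inter hZ).mem_of_tendsto hlim (.of_forall fun n ↦ hs _), ψ, hψ, hlim⟩

end NoncompactSequences

theorem exists_injOn_nat_of_pairwiseDisjoint {ι α : Type*} {S : Set ι} {A : ι → Set α}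
    (hA : ∀ i ∈ S, (A i).Countable) (hd : ∀ i ∈ S, ∀ j ∈ S, ∀ a ∈ A i, a ∈ A j → i = j) :
    ∃ g : α → ℕ, ∀ i ∈ S, InjOn g (A i) := by
  classical
  choose! e he using fun i hi ↦ (countable_iff_exists_injOn.1 (hA i hi))
  refine ⟨fun a ↦ if h : ∃ i ∈ S, a ∈ A i then e h.choose a else 0, fun i hi ↦ ?_⟩
  refine (he i hi).congr fun a ha ↦ ?_
  have h : ∃ i ∈ S, a ∈ A i := ⟨i, hi, ha⟩
  rw [dif_pos h, hd i hi _ h.choose_spec.1 a ha h.choose_spec.2]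

/-- A Hilbert cube with sides tending to zero is compact for uniform convergence. -/
theorem isCompact_image_uniformFun {ι : Type*} {c : ι → ℝ} (hc : Tendsto c cofinite (𝓝 0)) :
    IsCompact ((fun h : ι → ℝ ↦ (UniformFun.ofFun fun i ↦ c i * h i : ι →ᵤ ℝ)) ''
      univ.pi fun _ ↦ Icc 0 1) := by
  refine (isCompact_univ_pi fun _ ↦ isCompact_Icc).image_of_continuousOn fun h hh ↦ ?_
  rw [ContinuousWithinAt, UniformFun.tendsto_iff_tendstoUniformly, Metric.tendstoUniformly_iff]
  intro ε hε
  have hfin : {i | ¬ |c i| < ε}.Finite := by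
    have := (Metric.tendsto_nhds.1 hc ε hε)
    simpa using this
  have hev : ∀ᶠ g in 𝓝[univ.pi fun _ ↦ Icc 0 1] h, ∀ i ∈ {i | ¬ |c i| < ε},
      dist (c i * h i) (c i * g i) < ε := by
    rw [eventually_all_finite hfin]
    intro i _
    have hcont : Continuous fun g : ι → ℝ ↦ dist (c i * h i) (c i * g i) := by fun_prop
    exact nhdsWithin_le_nhds ((hcont.tendsto h).eventually (gt_mem_nhds (by simpa using hε)))
  filter_upwards [hev, self_mem_nhdsWithin] with g hg hg' i
  by_cases hi : |c i| < ε
  · have h1 := hh i trivial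
    have h2 := hg' i trivial
    have h3 : |h i - g i| ≤ 1 := by
      rw [abs_le]
      constructor <;> linarith [h1.1, h1.2, h2.1, h2.2]
    simp only [Function.comp_apply, UniformFun.toFun_ofFun, Real.dist_eq, ← mul_sub, abs_mul]
    exact (mul_le_of_le_one_right (abs_nonneg _) h3).trans_lt hi
  · exact hg i hi

section WeightedEmbedding

variable {X : Type*} [MetricSpace X]

theorem continuous_weighted_uniformFun {ι : Type*} {φ : ι → X → ℝ} (c : ι → ℝ)
    (hφ : ∀ i, Continuous (φ i)) (hlf : LocallyFinite fun i ↦ Function.support (φ i)) :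
    Continuous fun x ↦ (UniformFun.ofFun fun i ↦ c i * φ i x : ι →ᵤ ℝ) := by
  rw [continuous_iff_continuousAt]
  intro x
  rw [ContinuousAt, UniformFun.tendsto_iff_tendstoUniformly, Metric.tendstoUniformly_iff]
  intro ε hε
  obtain ⟨U, hU, hfin⟩ := hlf x
  have hev : ∀ᶠ y in 𝓝 x, ∀ i ∈ {i | (Function.support (φ i) ∩ U).Nonempty},
      dist (c i * φ i x) (c i * φ i y) < ε := by
    rw [eventually_all_finite hfin]
    intro i _
    have := hφ i
    have hcont : Continuous fun y ↦ dist (c i * φ i x) (c i * φ i y) := by fun_prop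
    exact (hcont.tendsto x).eventually (gt_mem_nhds (by simpa using hε))
  filter_upwards [hev, hU] with y hy hyU i
  by_cases hi : (Function.support (φ i) ∩ U).Nonempty
  · exact hy i hi
  · have h0 : ∀ u ∈ U, φ i u = 0 := fun u hu ↦ by
      by_contra hne
      exact hi ⟨u, hne, hu⟩
    simpa [h0 x (mem_of_mem_nhds hU), h0 y hyU] using hε

theorem isEmbedding_weighted_uniformFun {φ : ℕ → X → X → ℝ} {c : ℕ → X → ℝ}
    (hc : ∀ k a, 0 < c k a) (hφ : ∀ k a, Continuous (φ k a))
    (hlf : ∀ k, LocallyFinite fun a ↦ Function.support (φ k a))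
    (hsupp : ∀ k a x, φ k a x ≠ 0 → dist x a < (1 / 2) ^ k) (hpos : ∀ k x, ∃ a, 0 < φ k a x) :
    IsEmbedding fun x k ↦ (UniformFun.ofFun fun a ↦ c k a * φ k a x : X →ᵤ ℝ) := by
  refine IsInducing.isEmbedding (isInducing_iff_nhds.2 fun x ↦ le_antisymm ?_ ?_)
  · exact (continuous_pi fun k ↦
      continuous_weighted_uniformFun (c k) (hφ k) (hlf k)).continuousAt.le_comap
  · intro s hs
    obtain ⟨ε, hε, hs⟩ := Metric.mem_nhds_iff.1 hs
    obtain ⟨k, hk⟩ := exists_pow_lt_of_lt_one (half_pos hε) (one_half_lt_one (α := ℝ))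
    obtain ⟨a, ha⟩ := hpos k x
    have hcont : Continuous fun y : ℕ → (X →ᵤ ℝ) ↦ UniformFun.toFun (y k) a :=
      (UniformFun.uniformContinuous_eval ℝ a).continuous.comp (continuous_apply k)
    refine mem_comap.2 ⟨{y | 0 < UniformFun.toFun (y k) a},
      (isOpen_lt continuous_const hcont).mem_nhds (mul_pos (hc k a) ha), fun y hy ↦ hs ?_⟩
    have hy' : φ k a y ≠ 0 := right_ne_zero_of_mul (ne_of_gt (show 0 < c k a * φ k a y from hy))
    have h1 := hsupp k a y hy'
    have h2 := hsupp k a x ha.ne'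
    rw [Metric.mem_ball]
    linarith [dist_triangle_right y x a]

end WeightedEmbedding

/-- If `Z` is closed and nowhere locally compact, then `X` embeds in a metrizable space in such a
way that no relatively open nonempty subset of `Z` has closed image. -/
theorem exists_isEmbedding_mapClusterPt {X : Type*} [MetricSpace X] {Z : Set X} (hZ : IsClosed Z)
    (hn : ∀ x ∈ Z, ∀ N ∈ 𝓝 x, ¬ IsCompact (N ∩ Z)) :
    ∃ Φ : X → ℕ → (X →ᵤ ℝ), IsEmbedding Φ ∧ ∀ V, IsOpen V → (V ∩ Z).Nonempty →
      ∃ s : ℕ → X, (∀ n, s n ∈ V ∩ Z) ∧ (∀ x, ¬ MapClusterPt x atTop s) ∧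
        ∃ y, MapClusterPt y atTop (Φ ∘ s) := by
  classical
  have hpu (k : ℕ) : ∃ p : PartitionOfUnity X X, p.IsSubordinate
      fun a ↦ Metric.ball a ((1 / 2) ^ k) :=
    PartitionOfUnity.exists_isSubordinate isClosed_univ _ (fun _ ↦ Metric.isOpen_ball)
      fun x _ ↦ mem_iUnion.2 ⟨x, Metric.mem_ball_self (by positivity)⟩
  choose p hp using hpu
  have hsupp (k : ℕ) (a x : X) (h : p k a x ≠ 0) : dist x a < (1 / 2) ^ k :=
    hp k a (subset_tsupport _ h)
  choose S hSZ hSsep hSnet using fun l : ℕ ↦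
    exists_separated_net Z (r := 4 * (1 / 2) ^ l) (by positivity)
  have hseq (l : ℕ) (z : X) : ∃ s : ℕ → X, z ∈ S l → (∀ n, s n ∈ Z) ∧
      (∀ n, dist (s n) z < (1 / 2) ^ l) ∧ (∀ x, ¬ MapClusterPt x atTop s) ∧
      ∀ k < l, {a | ∃ n, p k a (s n) ≠ 0}.Finite := by
    by_cases hz : z ∈ S l
    swap
    · exact ⟨fun _ ↦ z, fun h ↦ absurd h hz⟩
    choose M hM hfin using fun k ↦ (p k).locallyFinite z
    obtain ⟨s, hs, hs'⟩ := exists_seq_forall_not_mapClusterPt hZ (hn z (hSZ l hz))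
      (inter_mem (Metric.ball_mem_nhds z (show (0 : ℝ) < (1 / 2) ^ l by positivity))
        ((biInter_mem (finite_lt_nat l)).2 fun k _ ↦ hM k))
    exact ⟨s, fun _ ↦ ⟨fun n ↦ (hs n).2, fun n ↦ (hs n).1.1, hs', fun k hk ↦
      (hfin k).subset fun a ⟨n, hn⟩ ↦ ⟨s n, hn, mem_iInter₂.1 (hs n).1.2 k hk⟩⟩⟩
  choose s hs using hseq
  set A : ℕ → ℕ → X → Set X := fun k l z ↦ {a | ∃ n, p k a (s l z n) ≠ 0} with hA
  have hrank (k l : ℕ) : ∃ g : X → ℕ, l ≤ k → ∀ z ∈ S l, InjOn g (A k l z) := by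
    by_cases hl : l ≤ k
    swap
    · exact ⟨fun _ ↦ 0, fun h ↦ absurd h hl⟩
    obtain ⟨g, hg⟩ := exists_injOn_nat_of_pairwiseDisjoint (S := S l) (A := A k l)
      (fun z _ ↦ by
        have : A k l z = ⋃ n, {a | p k a (s l z n) ≠ 0} := by ext; simp [hA]
        rw [this]
        exact countable_iUnion fun n ↦ ((p k).locallyFinite.point_finite _).countable)
      (fun z hz w hw a ⟨m, hm⟩ ⟨n, hn⟩ ↦ by
        by_contra hne
        have h1 := hsupp k a _ hm
        have h2 := hsupp k a _ hn
        have h3 := (hs l z hz).2.1 m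
        have h4 := (hs l w hw).2.1 n
        have h5 : (4 : ℝ) * (1 / 2) ^ l ≤ dist z w := hSsep l hz hw hne
        have h6 : ((1 : ℝ) / 2) ^ k ≤ (1 / 2) ^ l :=
          pow_le_pow_of_le_one (by norm_num) (by norm_num) hl
        have h7 := dist_triangle_left z w (s l z m)
        have h8 := dist_triangle (s l z m) a w
        have h9 := dist_triangle_left a w (s l w n)
        linarith)
    exact ⟨g, fun _ ↦ hg⟩
  choose g hg using hrank
  set c : ℕ → X → ℝ := fun k a ↦ 1 / (1 + ∑ l ∈ Finset.range (k + 1), (g k l a : ℝ)) with hc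
  have hcpos (k : ℕ) (a : X) : 0 < c k a := by positivity
  refine ⟨fun x k ↦ UniformFun.ofFun fun a ↦ c k a * p k a x,
    isEmbedding_weighted_uniformFun hcpos (fun k a ↦ (p k a).continuous)
      (fun k ↦ (p k).locallyFinite) hsupp fun k x ↦ (p k).exists_pos (mem_univ x), ?_⟩
  rintro V hV ⟨z, hzV, hzZ⟩
  obtain ⟨r, hr, hrV⟩ := Metric.isOpen_iff.1 hV z hzV
  obtain ⟨l, hl⟩ := exists_pow_lt_of_lt_one (show 0 < r / 5 by positivity)
    (one_half_lt_one (α := ℝ))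
  obtain ⟨w, hw, hzw⟩ := hSnet l z hzZ
  obtain ⟨hsZ, hsw, hscl, hsfin⟩ := hs l w hw
  refine ⟨s l w, fun n ↦ ⟨hrV ?_, hsZ n⟩, hscl, ?_⟩
  · rw [Metric.mem_ball]
    rw [dist_comm] at hzw
    linarith [dist_triangle (s l w n) w z, hsw n]
  have hlim (k : ℕ) : Tendsto ((A k l w).indicator (c k)) cofinite (𝓝 0) := by
    rw [Metric.tendsto_nhds]
    intro ε hε
    rw [eventually_cofinite]
    have hfin : {a ∈ A k l w | ε ≤ c k a}.Finite := by
      rcases lt_or_ge k l with hkl | hkl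
      · exact (hsfin k hkl).subset fun a ha ↦ ha.1
      · have hinj : InjOn (g k l) {a ∈ A k l w | ε ≤ c k a} :=
          (hg k l hkl w hw).mono fun a ha ↦ ha.1
        refine Finite.of_finite_image ((finite_le_nat ⌊1 / ε⌋₊).subset ?_) hinj
        rintro _ ⟨a, ⟨-, ha⟩, rfl⟩
        refine Nat.le_floor ?_
        have h1 : (g k l a : ℝ) ≤ ∑ l ∈ Finset.range (k + 1), (g k l a : ℝ) :=
          Finset.single_le_sum (f := fun l ↦ (g k l a : ℝ)) (fun _ _ ↦ by positivity)
            (Finset.mem_range.2 (by lia))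
        have h2 : 0 < 1 + ∑ l ∈ Finset.range (k + 1), (g k l a : ℝ) := by positivity
        rw [le_div_iff₀ hε]
        have h3 := (le_div_iff₀ h2).1 ha
        nlinarith
    refine hfin.subset fun a ha ↦ ?_
    by_cases haA : a ∈ A k l w
    · refine ⟨haA, ?_⟩
      simpa [haA, abs_of_pos (hcpos k a)] using ha
    · exact absurd hε (not_lt.2 (by simpa [haA] using ha))
  have hcpt := isCompact_univ_pi fun k ↦ isCompact_image_uniformFun (hlim k)
  obtain ⟨y, -, hy⟩ := hcpt.exists_mapClusterPt (f := atTop)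
    (u := (fun x k ↦ (UniformFun.ofFun fun a ↦ c k a * p k a x : X →ᵤ ℝ)) ∘ s l w) <| by
      refine tendsto_principal.2 (.of_forall fun n k _ ↦ ⟨fun a ↦ p k a (s l w n),
        fun a _ ↦ ⟨(p k).nonneg a _, (p k).le_one a _⟩, ?_⟩)
      refine congrArg UniformFun.ofFun (funext fun a ↦ ?_)
      by_cases ha : a ∈ A k l w
      · simp [ha]
      · have : p k a (s l w n) = 0 := by
          by_contra hne
          exact ha ⟨n, hne⟩
        simp [this]
  exact ⟨y, hy⟩

theorem exists_nonempty_inter_subset_of_isComplete {X : Type*} [MetricSpace X] {K : Set X}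
    (hK : IsComplete K) (hne : K.Nonempty) {C : ℕ → Set X} (hC : ∀ n, IsClosed (C n))
    (hKC : K ⊆ ⋃ n, C n) : ∃ n, ∃ V, IsOpen V ∧ (V ∩ K).Nonempty ∧ V ∩ K ⊆ C n := by
  have : CompleteSpace K := completeSpace_coe_iff_isComplete.2 hK
  have : Nonempty K := hne.to_subtype
  obtain ⟨n, x, hx⟩ := nonempty_interior_of_iUnion_of_closed
    (f := fun n ↦ (Subtype.val ⁻¹' C n : Set K))
    (fun n ↦ (hC n).preimage continuous_subtype_val)
    (by rw [← preimage_iUnion]; exact eq_univ_of_forall fun x ↦ hKC x.2)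
  obtain ⟨U, hU, hUo, hxU⟩ := mem_interior.1 hx
  obtain ⟨V, hV, rfl⟩ := isOpen_induced_iff.1 hUo
  exact ⟨n, V, hV, ⟨x, hxU, x.2⟩, fun y hy ↦ @hU ⟨y, hy.2⟩ hy.1⟩

/-- If `X` is metrizable and the space `AM*(X)` of all admissible
metrics on `X`, with the topology of uniform convergence, is completely metrizable,
then `X` is σ-locally compact. -/
theorem sigmaLocallyCompact_of_completelyMetrizable_AMstar (X : Type*) [TopologicalSpace X]
    [TopologicalSpace.MetrizableSpace X] (h : CompletelyMetrizable ↥(AMstar X)) :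
    SigmaLocallyCompact X := by
  let _ := TopologicalSpace.metrizableSpaceMetric X
  refine SigmaLocallyCompactCovered.sigmaLocallyCompact ?_
  obtain ⟨F, hF, hFX⟩ := exists_isClosed_iUnion_eq_range h
    (UniformSpace.Completion.coe_isometry (α := X)).isEmbedding
  have hFu : ⋃ n, ((↑) : X → UniformSpace.Completion X) ⁻¹' F n = univ := by
    rw [← preimage_iUnion, hFX, preimage_range]
  rw [← hFu]
  refine .iUnion fun n ↦ ?_
  by_contra hcov
  obtain ⟨K, hKF, hK, hKne, hKn⟩ := exists_isClosed_nowhere_locallyCompact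
    ((hF n).preimage (UniformSpace.Completion.continuous_coe X)) hcov
  have hFc : IsComplete (((↑) : X → UniformSpace.Completion X) ⁻¹' F n) := by
    rw [← UniformSpace.Completion.coe_isometry.isUniformInducing.isComplete_iff,
      image_preimage_eq_of_subset (hFX ▸ subset_iUnion F n)]
    exact (hF n).isComplete
  have hKc : IsComplete K := fun g hg hgK ↦ by
    obtain ⟨x, -, hx⟩ := hFc g hg (hgK.trans (principal_mono.2 hKF))
    have := hg.1
    exact ⟨x, hK.mem_of_tendsto hx (le_principal_iff.1 hgK), hx⟩
  obtain ⟨Φ, hΦ, hseq⟩ := exists_isEmbedding_mapClusterPt hK hKn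
  obtain ⟨F', hF', hFX'⟩ := exists_isClosed_iUnion_eq_range h hΦ
  obtain ⟨m, V, hV, hVne, hVF⟩ := exists_nonempty_inter_subset_of_isComplete hKc hKne
    (C := fun m ↦ Φ ⁻¹' F' m) (fun m ↦ (hF' m).preimage hΦ.continuous)
    (by rw [← preimage_iUnion, hFX', preimage_range]; exact subset_univ K)
  obtain ⟨s, hs, hscl, y, hy⟩ := hseq V hV hVne
  have hyF : y ∈ F' m := (hF' m).mem_of_mapClusterPt hy (.of_forall fun i ↦ hVF (hs i))
  obtain ⟨x, rfl⟩ : y ∈ range Φ := hFX' ▸ mem_iUnion.2 ⟨m, hyF⟩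
  exact hscl x ((hΦ.isInducing.mapClusterPt_iff (l := map s atTop)).1 hy)
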